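/- Equivalence up to an unknown bounded regular resynchronizer is undecidable: there is no algorithm that decides, given (codes of) two one-way nondeterministic transducers T₁ and T₂, whether T₁ ∼ T₂, i.e., whether both T₁ ⪯ T₂ and T₂ ⪯ T₁ hold. -/

import Mathlib

/-- An annotated letter over `Σ × {0,1}^(m+2)`: an input letter together with `m`
parameter bits and two marker bits (for the source position `x` and target position `y`). -/
abbrev RLetter (Sig : Type) (m : ℕ) : Type :=
  Sig × (Fin m → Bool) × Bool × Bool

/-- The word over `Σ × {0,1}^(m+2)` annotating `u` with the parameter valuation `Ī`
(positions are 1-indexed, parameters given by their characteristic functions) and with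
marker bits at positions `x` and `y`. -/
def annot {Sig : Type} {m : ℕ} (u : List Sig) (I : Fin m → ℕ → Bool)
    (x y : ℕ) : List (RLetter Sig m) :=
  u.mapIdx fun j a => (a, fun i => I i (j + 1), decide (j + 1 = x), decide (j + 1 = y))

/-- `(u, Ī, x, y) ⊨ γ`. -/
def RSat {Sig : Type} {m : ℕ} (γ : Set (List (RLetter Sig m)))
    (u : List Sig) (I : Fin m → ℕ → Bool) (x y : ℕ) : Prop :=
  annot u I x y ∈ γ

/-- A language is regular if it is accepted by a deterministic finite automaton. -/
def IsRegularLang {α : Type} (L : Set (List α)) : Prop :=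
  ∃ (Q : Type) (_ : Fintype Q) (M : DFA α Q), M.accepts = L

/-- A resynchronizer (given by its language `γ` with `m` input parameters) is bounded by `k`
if for every input word `u`, parameters `Ī` and position `y` of `u`, there are at most `k`
distinct positions `x` of `u` with `(u, Ī, x, y) ⊨ γ`. -/
def BoundedBy {Sig : Type} {m : ℕ} (γ : Set (List (RLetter Sig m))) (k : ℕ) : Prop :=
  ∀ (u : List Sig) (I : Fin m → ℕ → Bool) (y : ℕ), 1 ≤ y → y ≤ u.length →
    {x : ℕ | 1 ≤ x ∧ x ≤ u.length ∧ RSat γ u I x y}.ncard ≤ k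

/-- A resynchronizer is bounded if it is bounded by some `k`. -/
def BoundedResync {Sig : Type} {m : ℕ} (γ : Set (List (RLetter Sig m))) : Prop :=
  ∃ k, BoundedBy γ k

/-- An origin graph: a nonempty input word `u`, an output word `v`, and an origin map
sending every (1-indexed) position of `v` to a position of `u`. -/
structure OriginGraph (Sig Gam : Type) where
  inp : List Sig
  out : List Gam
  orig : ℕ → ℕ
  inp_ne : inp ≠ []
  orig_mem : ∀ t, 1 ≤ t → t ≤ out.length → 1 ≤ orig t ∧ orig t ≤ inp.length

/-- `(g, g') ∈ ⟦R⟧` for the resynchronizer with language `γ`: same input and output,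
and for some choice of input parameters, every output position has its `g`-origin
redirected to its `g'`-origin as allowed by `γ`. -/
def ResyncRel {Sig Gam : Type} {m : ℕ} (γ : Set (List (RLetter Sig m)))
    (g g' : OriginGraph Sig Gam) : Prop :=
  g.inp = g'.inp ∧ g.out = g'.out ∧
    ∃ I : Fin m → ℕ → Bool,
      ∀ z, 1 ≤ z → z ≤ g'.out.length → RSat γ g.inp I (g.orig z) (g'.orig z)

/-- `S₁ ⊆ R(S₂)` for the resynchronizer with language `γ`. -/
def ContainedUpTo {Sig Gam : Type} {m : ℕ} (γ : Set (List (RLetter Sig m)))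
    (S₁ S₂ : Set (OriginGraph Sig Gam)) : Prop :=
  ∀ g₁ ∈ S₁, ∃ g₂ ∈ S₂, ResyncRel γ g₂ g₁

/-- `S₁ ⪯ S₂`: there is a bounded regular resynchronizer `R` with `S₁ ⊆ R(S₂)`. -/
def ResyncLE {Sig Gam : Type} (S₁ S₂ : Set (OriginGraph Sig Gam)) : Prop :=
  ∃ (m : ℕ) (γ : Set (List (RLetter Sig m))),
    IsRegularLang γ ∧ BoundedResync γ ∧ ContainedUpTo γ S₁ S₂

/-- Input position `x` traverses input position `z` (with respect to the pair `(g, g')`). -/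
def Traverses {Sig Gam : Type} (g g' : OriginGraph Sig Gam) (x z : ℕ) : Prop :=
  ∃ t, 1 ≤ t ∧ t ≤ g.out.length ∧ g.orig t = x ∧
    ((x ≤ z ∧ z < g'.orig t) ∨ (g'.orig t < z ∧ z ≤ x))

/-- The pair `(g, g')` has `k`-traversal: every input position `z` is traversed by at
most `k` distinct positions. -/
def HasTraversal {Sig Gam : Type} (k : ℕ) (g g' : OriginGraph Sig Gam) : Prop :=
  ∀ z, 1 ≤ z → z ≤ g.inp.length → {x : ℕ | Traverses g g' x z}.ncard ≤ k


/-- A transition of a one-way nondeterministic transducer: source state, input letter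
(`none` for an ε-transition), output word, target state. States and letters are
natural numbers. -/
abbrev NTrans : Type := ℕ × Option ℕ × List ℕ × ℕ

/-- A one-way nondeterministic transducer (1NT), as a finite object: the list of
transitions, the list of initial states and the list of final states. -/
abbrev NT1 : Type := List NTrans × List ℕ × List ℕ

/-- Given the number `c` of input letters consumed so far, compute from a sequence of
transitions the triple (input word, output word, list of origins of the output positions).
The output produced while reading the input letter at position `j` gets origin `j`;
output produced by an ε-transition gets as origin the last input position read so far
(position `1` if no input has been read yet, position `|u|` if the whole input has been
consumed). -/
def runData : ℕ → List NTrans → List ℕ × List ℕ × List ℕ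
  | _, [] => ([], [], [])
  | c, tr :: rest =>
    match tr.2.1 with
    | some a =>
        let r := runData (c + 1) rest
        (a :: r.1, tr.2.2.1 ++ r.2.1, tr.2.2.1.map (fun _ => c + 1) ++ r.2.2)
    | none =>
        let r := runData c rest
        (r.1, tr.2.2.1 ++ r.2.1, tr.2.2.1.map (fun _ => max c 1) ++ r.2.2)

/-- `ts` is (the sequence of transitions of) an accepting run of the 1NT `T`. -/
def IsRun (T : NT1) (ts : List NTrans) : Prop :=
  ts ≠ [] ∧ (∀ tr ∈ ts, tr ∈ T.1) ∧
    (ts.head?.elim False fun tr => tr.1 ∈ T.2.1) ∧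
    (ts.getLast?.elim False fun tr => tr.2.2.2 ∈ T.2.2) ∧
    ts.Chain' (fun s t => s.2.2.2 = t.1)

/-- The origin semantics `⟦T⟧ᵒ` of a 1NT: the set of origin graphs of accepting runs
of `T` (on nonempty inputs). -/
def OSem (T : NT1) : Set (OriginGraph ℕ ℕ) :=
  { g | ∃ ts, IsRun T ts ∧
      g.inp = (runData 0 ts).1 ∧
      g.out = (runData 0 ts).2.1 ∧
      ∀ z, 1 ≤ z → z ≤ g.out.length → g.orig z = ((runData 0 ts).2.2).getD (z - 1) 1 }

/-- One step of a queue automaton with control `δ`: the first letter of the queue is removed, and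
the word produced by the control is appended at the end. -/
def queueStep {S A : Type} (δ : S → A → Option (S × List A)) :
    S × List A → Option (S × List A)
  | (_, []) => none
  | (s, a :: w) => (δ s a).map fun r => (r.1, w ++ r.2)

namespace QueueSim

open StateTransition Relation Turing Turing.TM2

section Rotation

variable {S A : Type} {δ : S → A → Option (S × List A)}

theorem reaches_rotate {s : S} (x y : List A) (h : ∀ a ∈ x, δ s a = some (s, [a])) :
    Reaches (queueStep δ) (s, x ++ y) (s, y ++ x) := by
  induction x generalizing y with
  | nil =>
    rw [List.nil_append, List.append_nil]
    exact ReflTransGen.refl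
  | cons a x ih =>
    refine Relation.ReflTransGen.head (b := (s, x ++ (y ++ [a]))) ?_ ?_
    · simp [queueStep, h a (by simp)]
    · simpa [StateTransition.Reaches] using ih (y ++ [a]) fun b hb => h b (by simp [hb])

theorem reaches₁_step {s s' : S} {a : A} {p w : List A} {c : S × List A}
    (h : δ s a = some (s', p)) (hc : Reaches (queueStep δ) (s', w ++ p) c) :
    Reaches₁ (queueStep δ) (s, a :: w) c :=
  TransGen.head' (by simp [queueStep, h]) hc

end Rotation

variable {K G Λ σ : Type}

/-- States of the queue automaton simulating a multi-stack machine: the statement being executed,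
the internal variables, and a flag telling that the next letter is the top of the stack concerned
by the statement. -/
abbrev SimState (K G Λ σ : Type) : Type := Stmt (fun _ : K => G) Λ σ × σ × Bool

/-- Control of the queue automaton simulating a multi-stack machine. The queue holds the contents
of the stacks, each preceded by the name of the stack and followed by an end marker. -/
def simControl [DecidableEq K] (M : Λ → Stmt (fun _ : K => G) Λ σ) :
    SimState K G Λ σ → K ⊕ Option G → Option (SimState K G Λ σ × List (K ⊕ Option G))
  | (.push k f q, v, b), .inl j =>
      if j = k then some ((q, v, false), [.inl j, .inr (some (f v))])
      else some ((.push k f q, v, b), [.inl j])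
  | (.peek k f q, v, _), .inl j => some ((.peek k f q, v, decide (j = k)), [.inl j])
  | (.pop k f q, v, _), .inl j => some ((.pop k f q, v, decide (j = k)), [.inl j])
  | (.load a q, v, _), .inl j => some ((q, a v, false), [.inl j])
  | (.branch p q₁ q₂, v, _), .inl j => some ((cond (p v) q₁ q₂, v, false), [.inl j])
  | (.goto l, v, _), .inl j => some ((M (l v), v, false), [.inl j])
  | (.halt, v, false), .inl j => some ((.halt, v, true), [.inl j])
  | (.halt, _, true), .inl _ => none
  | (.peek _ f q, v, true), .inr o => some ((q, f v o, false), [.inr o])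
  | (.pop _ f q, v, true), .inr o =>
      some ((q, f v o, false), if o.isSome then [] else [.inr o])
  | s, .inr o => some (s, [.inr o])

/-- The control state representing the label and the variables of a configuration. -/
def simState (M : Λ → Stmt (fun _ : K => G) Λ σ) (c : Cfg (fun _ : K => G) Λ σ) :
    SimState K G Λ σ :=
  match c.l with
  | some l => (M l, c.var, false)
  | none => (.halt, c.var, true)

/-- The contents of a stack, followed by an end marker. -/
def stackWord (L : List G) : List (K ⊕ Option G) :=
  L.map (fun g => .inr (some g)) ++ [.inr none]

/-- The contents of the stacks listed in `ks`. -/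
def stacksWord (T : K → List G) (ks : List K) : List (K ⊕ Option G) :=
  ks.flatMap fun k => .inl k :: stackWord (T k)

/-- The queue `w` represents the stacks `T`, listed in an arbitrary order. -/
def Represents (T : K → List G) (w : List (K ⊕ Option G)) : Prop :=
  ∃ ks : List K, ks.Nodup ∧ (∀ k, k ∈ ks) ∧ w = stacksWord T ks

variable {M : Λ → Stmt (fun _ : K => G) Λ σ}

theorem eq_inr_of_mem_stackWord {L : List G} {a : K ⊕ Option G} (h : a ∈ stackWord L) :
    ∃ o, a = .inr o := by
  simp only [stackWord, List.mem_append, List.mem_map, List.mem_singleton] at h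
  rcases h with ⟨g, -, rfl⟩ | rfl <;> exact ⟨_, rfl⟩

theorem mem_of_inl_mem_stacksWord {T : K → List G} {ks : List K} {j : K}
    (h : .inl j ∈ stacksWord T ks) : j ∈ ks := by
  simp only [stacksWord, List.mem_flatMap, List.mem_cons, Sum.inl.injEq] at h
  obtain ⟨k, hk, rfl | h⟩ := h
  · exact hk
  · obtain ⟨o, ho⟩ := eq_inr_of_mem_stackWord h
    simp at ho

theorem stacksWord_append (T : K → List G) (l₁ l₂ : List K) :
    stacksWord T (l₁ ++ l₂) = stacksWord T l₁ ++ stacksWord T l₂ := by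
  simp [stacksWord]

variable [DecidableEq K]

theorem stacksWord_update (T : K → List G) {k : K} {ks : List K} (h : k ∉ ks) (L : List G) :
    stacksWord (Function.update T k L) ks = stacksWord T ks := by
  unfold stacksWord
  refine List.flatMap_congr fun j hj => ?_
  rw [Function.update_of_ne (by rintro rfl; exact h hj)]

theorem simControl_inr (q : Stmt (fun _ : K => G) Λ σ) (v : σ) (o : Option G) :
    simControl M (q, v, false) (.inr o) = some ((q, v, false), [.inr o]) := by
  cases q <;> rfl

theorem reaches_skip_stack (q : Stmt (fun _ : K => G) Λ σ) (v : σ) (L : List G)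
    (y : List (K ⊕ Option G)) {w w' : List (K ⊕ Option G)} (hw : w = stackWord L ++ y)
    (hw' : w' = y ++ stackWord L) :
    Reaches (queueStep (simControl M)) ((q, v, false), w) ((q, v, false), w') := by
  subst hw hw'
  refine reaches_rotate _ _ fun a ha => ?_
  obtain ⟨o, rfl⟩ := eq_inr_of_mem_stackWord ha
  exact simControl_inr q v o

/-- A statement not concerning the stacks is executed when reading the name of any stack. -/
theorem exists_reaches₁_of_forall [Inhabited K] {T : K → List G} {w : List (K ⊕ Option G)}
    (hw : Represents T w) {s s' : SimState K G Λ σ}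
    (h : ∀ j, simControl M s (.inl j) = some (s', [.inl j]))
    (h' : ∀ o, simControl M s' (.inr o) = some (s', [.inr o])) :
    ∃ w', Represents T w' ∧ Reaches₁ (queueStep (simControl M)) (s, w) (s', w') := by
  obtain ⟨ks, hn, hk, rfl⟩ := hw
  cases ks with
  | nil => simpa using hk default
  | cons k ks =>
    refine ⟨stacksWord T (ks ++ [k]), ⟨ks ++ [k], ?_, ?_, rfl⟩, ?_⟩
    · rw [← List.concat_eq_append, List.nodup_concat]
      exact (List.nodup_cons.1 hn)
    · intro j
      have := hk j
      simp at this ⊢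
      tauto
    · refine reaches₁_step (w := stackWord (T k) ++ stacksWord T ks) (h k) ?_
      have := reaches_rotate (δ := simControl M) (s := s') (stackWord (T k))
        (stacksWord T ks ++ [.inl k]) fun a ha => by
          obtain ⟨o, rfl⟩ := eq_inr_of_mem_stackWord ha
          exact h' o
      simpa [stacksWord] using this

/-- The queue can be rotated until the name of the wanted stack is read. -/
theorem exists_reaches_stack {T : K → List G} {w : List (K ⊕ Option G)} (hw : Represents T w)
    (k : K) {q : Stmt (fun _ : K => G) Λ σ} {v : σ}
    (h : ∀ j, j ≠ k → simControl M (q, v, false) (.inl j) = some ((q, v, false), [.inl j])) :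
    ∃ l, (l ++ [k]).Nodup ∧ (∀ j, j ∈ l ++ [k]) ∧
      Reaches (queueStep (simControl M)) ((q, v, false), w)
        ((q, v, false), .inl k :: (stackWord (T k) ++ stacksWord T l)) := by
  obtain ⟨ks, hn, hk, rfl⟩ := hw
  obtain ⟨l₁, l₂, rfl⟩ := List.append_of_mem (hk k)
  have hp : (l₂ ++ l₁ ++ [k]).Perm (l₁ ++ k :: l₂) := by
    refine (List.perm_append_singleton _ _).trans ?_
    refine List.Perm.trans ?_ List.perm_middle.symm
    exact List.Perm.cons _ List.perm_append_comm
  have hk₁ : k ∉ l₁ := by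
    rw [List.nodup_append] at hn
    exact fun hm => hn.2.2 k hm k (by simp) rfl
  refine ⟨l₂ ++ l₁, hp.nodup_iff.2 hn, fun j => hp.mem_iff.2 (hk j), ?_⟩
  have := reaches_rotate (δ := simControl M) (s := (q, v, false)) (stacksWord T l₁)
    (stacksWord T (k :: l₂)) fun a ha => by
      rcases a with j | o
      · exact h j fun e => hk₁ (e ▸ mem_of_inl_mem_stacksWord ha)
      · exact simControl_inr q v o
  rw [stacksWord_append]
  simpa [stacksWord] using this

theorem represents_update {T : K → List G} {l : List K} {k : K} (hn : (l ++ [k]).Nodup)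
    (hk : ∀ j, j ∈ l ++ [k]) (L : List G) :
    Represents (Function.update T k L) (stacksWord T l ++ .inl k :: stackWord L) := by
  refine ⟨l ++ [k], hn, hk, ?_⟩
  have : k ∉ l := by
    rw [List.nodup_append] at hn
    exact fun hm => hn.2.2 k hm k (by simp) rfl
  rw [stacksWord_append, stacksWord_update T this]
  simp [stacksWord]

theorem exists_reaches₁_push {T : K → List G} {w : List (K ⊕ Option G)} (hw : Represents T w)
    (k : K) (f : σ → G) (q : Stmt (fun _ : K => G) Λ σ) (v : σ) :
    ∃ w', Represents (Function.update T k (f v :: T k)) w' ∧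
      Reaches₁ (queueStep (simControl M)) ((.push k f q, v, false), w) ((q, v, false), w') := by
  obtain ⟨l, hn, hk, hr⟩ := exists_reaches_stack (M := M) hw k (q := .push k f q) (v := v)
    fun j hj => by simp [simControl, hj]
  refine ⟨_, represents_update hn hk _, TransGen.trans_right hr ?_⟩
  refine reaches₁_step (by simp only [simControl, if_true]; rfl) ?_
  exact reaches_skip_stack (M := M) q v (T k)
    (stacksWord T l ++ [.inl k, .inr (some (f v))])
      (by simp [stackWord]) (by simp [stackWord])

theorem exists_reaches₁_peek {T : K → List G} {w : List (K ⊕ Option G)} (hw : Represents T w)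
    (k : K) (f : σ → Option G → σ) (q : Stmt (fun _ : K => G) Λ σ) (v : σ) :
    ∃ w', Represents T w' ∧ Reaches₁ (queueStep (simControl M)) ((.peek k f q, v, false), w)
      ((q, f v (T k).head?, false), w') := by
  obtain ⟨l, hn, hk, hr⟩ := exists_reaches_stack (M := M) hw k (q := .peek k f q) (v := v)
    fun j hj => by simp [simControl, hj]
  have hw' := represents_update (T := T) hn hk (T k)
  rw [Function.update_eq_self] at hw'
  refine ⟨_, hw', TransGen.trans_right hr ?_⟩
  refine reaches₁_step (by simp only [simControl, decide_true]; rfl) ?_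
  cases hT : T k with
  | nil =>
    refine (reaches₁_step (δ := simControl M)
      (s := (.peek k f q, v, true)) (a := Sum.inr none) rfl ?_).to_reflTransGen
    rw [show stacksWord T l ++ Sum.inl k :: stackWord [] =
      [] ++ stacksWord T l ++ [Sum.inl k] ++ [Sum.inr none] by simp [stackWord]]
    exact ReflTransGen.refl
  | cons g L =>
    refine (reaches₁_step (δ := simControl M)
      (s := (.peek k f q, v, true)) (a := Sum.inr (some g))
      (w := stackWord L ++ stacksWord T l ++ [.inl k]) rfl ?_).to_reflTransGen
    exact reaches_skip_stack (M := M) q (f v (some g)) L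
      (stacksWord T l ++ [.inl k, .inr (some g)])
      (by simp [stackWord]) (by simp [stackWord])

theorem exists_reaches₁_pop {T : K → List G} {w : List (K ⊕ Option G)} (hw : Represents T w)
    (k : K) (f : σ → Option G → σ) (q : Stmt (fun _ : K => G) Λ σ) (v : σ) :
    ∃ w', Represents (Function.update T k (T k).tail) w' ∧
      Reaches₁ (queueStep (simControl M)) ((.pop k f q, v, false), w)
        ((q, f v (T k).head?, false), w') := by
  obtain ⟨l, hn, hk, hr⟩ := exists_reaches_stack (M := M) hw k (q := .pop k f q) (v := v)
    fun j hj => by simp [simControl, hj]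
  refine ⟨_, represents_update hn hk _, TransGen.trans_right hr ?_⟩
  refine reaches₁_step (by simp only [simControl, decide_true]; rfl) ?_
  cases hT : T k with
  | nil =>
    refine (reaches₁_step (δ := simControl M)
      (s := (.pop k f q, v, true)) (a := Sum.inr none) rfl ?_).to_reflTransGen
    rw [List.tail_nil, show stacksWord T l ++ Sum.inl k :: stackWord [] =
      [] ++ stacksWord T l ++ [Sum.inl k] ++ [Sum.inr none] by simp [stackWord]]
    exact ReflTransGen.refl
  | cons g L =>
    refine (reaches₁_step (δ := simControl M)
      (s := (.pop k f q, v, true)) (a := Sum.inr (some g))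
      (w := stackWord L ++ stacksWord T l ++ [.inl k]) rfl ?_).to_reflTransGen
    exact reaches_skip_stack (M := M) q (f v (some g)) L
      (stacksWord T l ++ [.inl k])
      (by simp [stackWord]) (by simp [stackWord])

theorem exists_reaches₁_stepAux [Inhabited K] (q : Stmt (fun _ : K => G) Λ σ) (v : σ)
    (T : K → List G) {w : List (K ⊕ Option G)} (hw : Represents T w) :
    ∃ w', Represents (stepAux q v T).stk w' ∧
      Reaches₁ (queueStep (simControl M)) ((q, v, false), w)
        (simState M (stepAux q v T), w') := by
  induction q generalizing v T w with
  | push k f q ih =>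
    obtain ⟨w₁, hw₁, h₁⟩ := exists_reaches₁_push (M := M) hw k f q v
    obtain ⟨w₂, hw₂, h₂⟩ := ih _ _ hw₁
    exact ⟨w₂, hw₂, h₁.trans h₂⟩
  | peek k f q ih =>
    obtain ⟨w₁, hw₁, h₁⟩ := exists_reaches₁_peek (M := M) hw k f q v
    obtain ⟨w₂, hw₂, h₂⟩ := ih _ _ hw₁
    exact ⟨w₂, hw₂, h₁.trans h₂⟩
  | pop k f q ih =>
    obtain ⟨w₁, hw₁, h₁⟩ := exists_reaches₁_pop (M := M) hw k f q v
    obtain ⟨w₂, hw₂, h₂⟩ := ih _ _ hw₁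
    exact ⟨w₂, hw₂, h₁.trans h₂⟩
  | load a q ih =>
    obtain ⟨w₁, hw₁, h₁⟩ := exists_reaches₁_of_forall (M := M) hw
      (s := (.load a q, v, false)) (fun _ => rfl) (simControl_inr _ _)
    obtain ⟨w₂, hw₂, h₂⟩ := ih _ _ hw₁
    exact ⟨w₂, hw₂, h₁.trans h₂⟩
  | branch p q₁ q₂ ih₁ ih₂ =>
    obtain ⟨w₁, hw₁, h₁⟩ := exists_reaches₁_of_forall (M := M) hw
      (s := (.branch p q₁ q₂, v, false)) (fun _ => rfl) (simControl_inr _ _)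
    rw [stepAux]
    cases hp : p v with
    | true =>
      obtain ⟨w₂, hw₂, h₂⟩ := ih₁ v _ hw₁
      rw [hp] at h₁
      exact ⟨w₂, hw₂, h₁.trans h₂⟩
    | false =>
      obtain ⟨w₂, hw₂, h₂⟩ := ih₂ v _ hw₁
      rw [hp] at h₁
      exact ⟨w₂, hw₂, h₁.trans h₂⟩
  | goto l =>
    exact exists_reaches₁_of_forall (M := M) hw
      (s := (.goto l, v, false)) (fun _ => rfl) (simControl_inr _ _)
  | halt =>
    exact exists_reaches₁_of_forall (M := M) hw
      (s := (.halt, v, false)) (s' := (.halt, v, true)) (fun _ => rfl) fun _ => rfl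

/-- The queue automaton simulates the multi-stack machine. -/
theorem respects_sim [Inhabited K] (M : Λ → Stmt (fun _ : K => G) Λ σ) :
    Respects (step M) (queueStep (simControl M)) fun c d =>
      d.1 = simState M c ∧ Represents c.stk d.2 := by
  rintro ⟨l, v, T⟩ ⟨s, w⟩ ⟨hs, hw⟩
  obtain rfl : s = _ := hs
  cases l with
  | some l =>
    obtain ⟨w', hw', h⟩ := exists_reaches₁_stepAux (M := M) (M l) v T hw
    exact ⟨_, ⟨rfl, hw'⟩, h⟩
  | none =>
    obtain ⟨ks, -, hk, rfl⟩ := hw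
    cases ks with
    | nil => simpa using hk default
    | cons k ks => rfl

theorem simControl_mem_stmts [Inhabited Λ] {F : Finset Λ} (hF : Supports M F)
    {s s' : SimState K G Λ σ} {a : K ⊕ Option G} {p : List (K ⊕ Option G)}
    (hs : some s.1 ∈ stmts M F ∨ s.1 = .halt) (h : simControl M s a = some (s', p)) :
    some s'.1 ∈ stmts M F ∨ s'.1 = .halt := by
  classical
  obtain ⟨q, v, b⟩ := s
  rcases hs with hs | hs
  swap
  · right
    simp only at hs
    subst hs
    cases a <;> cases b <;> simp [simControl] at h <;> simp [← h.1]
  left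
  rcases a with j | o
  · cases q with
    | push k f q =>
      simp only [simControl] at h
      split_ifs at h <;> simp only [Option.some.injEq, Prod.mk.injEq] at h <;> rw [← h.1]
      · exact stmts_trans (by simp [stmts₁, stmts₁_self]) hs
      · exact hs
    | peek k f q => simp [simControl] at h; rw [← h.1]; exact hs
    | pop k f q => simp [simControl] at h; rw [← h.1]; exact hs
    | load f q =>
      simp [simControl] at h; rw [← h.1]
      exact stmts_trans (by simp [stmts₁, stmts₁_self]) hs
    | branch f q₁ q₂ =>
      simp [simControl] at h; rw [← h.1]
      cases f v <;> exact stmts_trans (by simp [stmts₁, stmts₁_self]) hs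
    | goto l =>
      simp [simControl] at h; rw [← h.1]
      have := stmts_supportsStmt hF hs
      simp only [SupportsStmt] at this
      simp only [stmts, Finset.mem_insertNone, Finset.mem_biUnion, Option.mem_def,
        Option.some.injEq, forall_eq']
      exact ⟨_, this v, stmts₁_self⟩
    | halt => cases b <;> simp [simControl] at h; rw [← h.1]; exact hs
  · cases q <;> cases b <;> simp [simControl] at h <;> rw [← h.1]
    all_goals first
      | exact hs
      | exact stmts_trans (by simp [stmts₁, stmts₁_self]) hs

end QueueSim

/-- Successor of a binary number, given by its list of digits starting from the least significant
one. -/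
def binarySucc : List Bool → List Bool
  | [] => [true]
  | false :: l => true :: l
  | true :: l => false :: binarySucc l

/-- The digits of a natural number. -/
def binaryDigits : ℕ → List Bool
  | 0 => []
  | n + 1 => binarySucc (binaryDigits n)

theorem primrec_binarySucc : Primrec binarySucc := by
  have h : Primrec fun l : List Bool =>
      (List.rec [true] (fun b t ih => cond b (false :: ih) (true :: t)) l : List Bool) := by
    refine Primrec.list_rec (f := fun l : List Bool => l) (g := fun _ => [true])
      (h := fun _ p => cond p.1 (false :: p.2.2) (true :: p.2.1)) Primrec.id (Primrec.const _) ?_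
    refine Primrec.cond (Primrec.fst.comp Primrec.snd) ?_ ?_
    · exact Primrec.list_cons.comp (Primrec.const _)
        (Primrec.snd.comp (Primrec.snd.comp Primrec.snd))
    · exact Primrec.list_cons.comp (Primrec.const _)
        (Primrec.fst.comp (Primrec.snd.comp Primrec.snd))
  refine h.of_eq fun l => ?_
  induction l with
  | nil => rfl
  | cons b l ih => cases b <;> simp [binarySucc, ih]

theorem primrec_binaryDigits : Primrec binaryDigits := by
  refine (Primrec.nat_rec₁ (f := fun _ l => binarySucc l) []
    (primrec_binarySucc.comp₂ Primrec₂.right)).of_eq fun n => ?_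
  induction n with
  | zero => rfl
  | succ n ih => simp only [binaryDigits, ← ih]

section

open Turing Turing.PartrecToTM2

theorem trPosNum_succ (p : PosNum) (l : List Bool)
    (h : trPosNum p = l.map fun b => cond b Γ'.bit1 Γ'.bit0) :
    trPosNum p.succ = (binarySucc l).map fun b => cond b Γ'.bit1 Γ'.bit0 := by
  induction p generalizing l with
  | one =>
    rcases l with _ | ⟨_ | _, _ | ⟨_, _⟩⟩ <;>
      simp_all [trPosNum, binarySucc, PosNum.succ]
  | bit0 p ih => rcases l with _ | ⟨_ | _, l⟩ <;> simp_all [trPosNum, binarySucc, PosNum.succ]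
  | bit1 p ih =>
    rcases l with _ | ⟨_ | _, l⟩
    · simp_all [trPosNum]
    · simp_all [trPosNum]
    · rw [trPosNum, List.map_cons, List.cons.injEq] at h
      simpa [trPosNum, binarySucc, PosNum.succ] using ih l h.2

theorem trNat_eq_binaryDigits (n : ℕ) :
    trNat n = (binaryDigits n).map fun b => cond b Γ'.bit1 Γ'.bit0 := by
  induction n with
  | zero => simp [binaryDigits]
  | succ n ih =>
    rw [trNat] at ih ⊢
    rw [Nat.cast_succ, Num.add_one]
    cases h : (n : Num) with
    | zero =>
      rw [h] at ih
      rw [binaryDigits]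
      have : binaryDigits n = [] := by simpa [trNum] using ih
      rw [this]
      rfl
    | pos p =>
      rw [h] at ih
      exact trPosNum_succ p _ ih

theorem finite_stackNames : Finite K' :=
  Finite.of_surjective (fun p : Bool × Bool => match p with
      | (true, true) => K'.main
      | (true, false) => K'.rev
      | (false, true) => K'.aux
      | (false, false) => K'.stack)
    fun k => by cases k <;> simp

end

section

open StateTransition Relation

/-- A queue automaton whose reachable control states are in a finite set can be restricted to that
set. -/
theorem exists_restrict_queue {S A : Type} (δ : S → A → Option (S × List A)) (F : Set S)
    (hF : ∀ s ∈ F, ∀ a s' p, δ s a = some (s', p) → s' ∈ F) :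
    ∃ δ' : F → A → Option (F × List A),
      Respects (queueStep δ) (queueStep δ') fun c d => c = (d.1.1, d.2) := by
  have h : ∀ (s : F) (a : A), ∃ r : Option (F × List A),
      r.map (fun x => (x.1.1, x.2)) = δ s a := by
    intro s a
    cases h : δ s a with
    | none => exact ⟨none, rfl⟩
    | some x => exact ⟨some (⟨x.1, hF s s.2 a x.1 x.2 h⟩, x.2), rfl⟩
  choose δ' hδ' using h
  refine ⟨δ', ?_⟩
  rintro _ ⟨s, w⟩ rfl
  rcases w with _ | ⟨a, w⟩
  · rfl
  · have h := hδ' s a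
    cases hd : δ' s a with
    | none =>
      rw [hd] at h
      simp [queueStep, ← h, hd]
    | some x =>
      rw [hd] at h
      simp only [queueStep, ← h, Option.map_some]
      exact ⟨(x.1, w ++ x.2), rfl, TransGen.single (by simp [queueStep, hd])⟩

open Turing Turing.PartrecToTM2 QueueSim in
/-- There is a queue automaton with a finite control for which the halting problem, depending on
the initial queue, is undecidable. -/
theorem exists_undecidable_queue :
    ∃ (S A : Type) (_ : Finite S) (_ : Finite A) (δ : S → A → Option (S × List A)) (s₀ : S)
      (w : ℕ → List A) (e : A → ℕ), e.Injective ∧ Computable (fun n => (w n).map e) ∧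
      ∀ c : Nat.Partrec.Code,
        ((c.eval 0).Dom → ∃ s a w', Reaches (queueStep δ) (s₀, w (Encodable.encode c)) (s, a :: w') ∧
          δ s a = none) ∧
        (¬ (c.eval 0).Dom → ¬ (eval (queueStep δ) (s₀, w (Encodable.encode c))).Dom) := by
  have hpart : Partrec fun n : ℕ => (Denumerable.ofNat Nat.Partrec.Code n).eval 0 :=
    Nat.Partrec.Code.eval_part.comp (Computable.ofNat _) (Computable.const 0)
  obtain ⟨c₀, hc₀⟩ := ToPartrec.Code.exists_code (Nat.Partrec'.part_iff₁.2 hpart)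
  have := finite_stackNames
  let l₀ := trNormal c₀ Cont'.halt
  let _ : Inhabited Λ' := ⟨l₀⟩
  have hs : TM2.Supports tr (codeSupp c₀ Cont'.halt) := tr_supports c₀ Cont'.halt
  let F : Set (SimState K' Γ' Λ' (Option Γ')) :=
    {s | some s.1 ∈ TM2.stmts tr (codeSupp c₀ Cont'.halt) ∨ s.1 = .halt}
  have hFfin : F.Finite := by
    have h₁ : {q : TM2.Stmt (fun _ : K' => Γ') Λ' (Option Γ') |
        some q ∈ TM2.stmts tr (codeSupp c₀ Cont'.halt) ∨ q = .halt}.Finite := by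
      refine Set.Finite.union ?_ (Set.finite_singleton _)
      exact (Finset.finite_toSet _).preimage (Option.some_injective _).injOn
    exact (h₁.prod (Set.toFinite (Set.univ : Set (Option Γ' × Bool)))).subset
      fun s hs => ⟨hs, trivial⟩
  obtain ⟨δ, hδ⟩ := exists_restrict_queue (simControl tr) F
    fun s h a s' p he => simControl_mem_stmts hs h he
  have hs₀ : (tr l₀, none, false) ∈ F := by
    left
    simp only [TM2.stmts, Finset.mem_insertNone, Finset.mem_biUnion, Option.mem_def]
    rintro _ ⟨⟩
    exact ⟨_, hs.1, TM2.stmts₁_self⟩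
  obtain ⟨e, he⟩ := exists_injective_nat (K' ⊕ Option Γ')
  let w : ℕ → List (K' ⊕ Option Γ') := fun n =>
    stacksWord (K'.elim (trList [n]) [] [] []) [K'.main, K'.rev, K'.aux, K'.stack]
  have hw : ∀ n, Represents (K'.elim (trList [n]) [] [] []) (w n) := fun n =>
    ⟨_, by simp, fun k => by cases k <;> simp, rfl⟩
  refine ⟨F, _, hFfin, inferInstance, δ, ⟨_, hs₀⟩, w, e, he, ?_, fun c => ?_⟩
  · have h : Primrec fun n => (binaryDigits n).map fun b =>
        cond b (e (.inr (some Γ'.bit1))) (e (.inr (some Γ'.bit0))) :=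
      Primrec.list_map primrec_binaryDigits ((Primrec.dom_finite _).comp₂ Primrec₂.right)
    refine (Primrec.to_comp (Primrec.list_cons.comp (Primrec.const (e (.inl K'.main)))
      (Primrec.list_append.comp h (Primrec.const (([Sum.inr (some Γ'.cons), .inr none] ++
        stacksWord (K'.elim [] [] [] []) [K'.rev, K'.aux, K'.stack]).map e))))).of_eq fun n => ?_
    simp only [w, trList, trNat_eq_binaryDigits, stacksWord, stackWord]
    simp
  · have hdom : (StateTransition.eval (TM2.step tr) (init c₀ [Encodable.encode c])).Dom ↔
        (c.eval 0).Dom := by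
      rw [PartrecToTM2.tr_eval]
      have h : c₀.eval [Encodable.encode c] = pure <$>
          (Denumerable.ofNat Nat.Partrec.Code (Encodable.encode c)).eval 0 :=
        hc₀ ⟨[Encodable.encode c], rfl⟩
      rw [h, Denumerable.ofNat_encode]
      simp
    have hsim : (fun (c : Cfg') (d : SimState K' Γ' Λ' (Option Γ') × _) =>
        d.1 = simState tr c ∧ Represents c.stk d.2) (init c₀ [Encodable.encode c])
        ((tr l₀, none, false), w (Encodable.encode c)) := ⟨rfl, hw _⟩
    constructor
    · intro hc
      have hc := hdom.2 hc
      obtain ⟨⟨s₁, w₁⟩, ⟨-, hw₁⟩, h₁⟩ := StateTransition.tr_eval (respects_sim tr) hsim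
        (Part.get_mem hc)
      obtain ⟨⟨s₂, w₂⟩, h₂₁, h₂⟩ := StateTransition.tr_eval hδ
        (a₂ := (⟨_, hs₀⟩, w (Encodable.encode c))) rfl h₁
      obtain ⟨h₃, h₄⟩ := mem_eval.1 h₂
      obtain ⟨-, rfl⟩ := Prod.mk.inj h₂₁
      obtain ⟨ks, -, hk, rfl⟩ := hw₁
      cases ks with
      | nil => simpa using hk default
      | cons k ks =>
        refine ⟨s₂, _, _, h₃, ?_⟩
        simpa [stacksWord, queueStep] using h₄
    · intro hc hd
      have h₁ := (StateTransition.tr_eval_dom hδ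
        (a₂ := (⟨_, hs₀⟩, w (Encodable.encode c))) rfl).1 hd
      exact hc (hdom.1 ((StateTransition.tr_eval_dom (respects_sim tr) hsim).1 h₁))

end

/-- `Accepts Tr fin c q u v o`: a transducer with transition relation `Tr` and final states `fin`, in
state `q` after reading `c` letters, can accept the remaining input `u` while producing the output
`v`, with list of origins `o`. -/
inductive Accepts {Q A B : Type} (Tr : Q → Option A → List B → Q → Prop) (fin : Q → Prop) :
    ℕ → Q → List A → List B → List ℕ → Prop
  | nil {c q} : fin q → Accepts Tr fin c q [] [] []
  | read {c q a p q' u v o} : Tr q (some a) p q' → Accepts Tr fin (c + 1) q' u v o →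
      Accepts Tr fin c q (a :: u) (p ++ v) (p.map (fun _ => c + 1) ++ o)
  | eps {c q p q' u v o} : Tr q none p q' → Accepts Tr fin c q' u v o →
      Accepts Tr fin c q u (p ++ v) (p.map (fun _ => max c 1) ++ o)

namespace Accepts

section Basic

variable {Q A B : Type} {Tr : Q → Option A → List B → Q → Prop} {fin : Q → Prop} {c : ℕ} {q : Q}
  {u : List A} {v : List B} {o : List ℕ}

theorem length_eq (h : Accepts Tr fin c q u v o) : o.length = v.length := by
  induction h with
  | nil => rfl
  | read _ _ ih => simp [ih]
  | eps _ _ ih => simp [ih]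

theorem origin_mem (h : Accepts Tr fin c q u v o) : ∀ x ∈ o, 1 ≤ x ∧ x ≤ max (c + u.length) 1 := by
  induction h with
  | nil => simp
  | read _ _ ih =>
    intro x hx
    rcases List.mem_append.1 hx with hx | hx
    · obtain ⟨_, -, rfl⟩ := List.mem_map.1 hx
      simp only [List.length_cons]
      omega
    · have := ih x hx
      simp only [List.length_cons]
      omega
  | eps _ _ ih =>
    intro x hx
    rcases List.mem_append.1 hx with hx | hx
    · obtain ⟨_, -, rfl⟩ := List.mem_map.1 hx
      omega
    · exact ih x hx

/-- Acceptance is preserved by an injective encoding of the states and letters. -/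
theorem map {Q' A' B' : Type} {Tr' : Q' → Option A' → List B' → Q' → Prop} {fin' : Q' → Prop}
    (f : Q → Q') (e : A → A') (e' : B → B')
    (hTr : ∀ q x p q', Tr q x p q' → Tr' (f q) (x.map e) (p.map e') (f q'))
    (hfin : ∀ q, fin q → fin' (f q)) (h : Accepts Tr fin c q u v o) :
    Accepts Tr' fin' c (f q) (u.map e) (v.map e') o := by
  induction h with
  | nil h => exact .nil (hfin _ h)
  | read h _ ih => simpa [Function.comp_def] using Accepts.read (hTr _ _ _ _ h) ih
  | eps h _ ih => simpa [Function.comp_def] using Accepts.eps (hTr _ _ _ _ h) ih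

theorem of_map {Q' A' B' : Type} {Tr' : Q' → Option A' → List B' → Q' → Prop} {fin' : Q' → Prop}
    {f : Q → Q'} (e : A → A') (e' : B → B') (hf : f.Injective)
    (hTr : ∀ r x p r', Tr' r x p r' →
      ∃ q y p' q', Tr q y p' q' ∧ f q = r ∧ y.map e = x ∧ p'.map e' = p ∧ f q' = r')
    (hfin : ∀ r, fin' r → ∃ q, fin q ∧ f q = r) {r : Q'} {u : List A'} {v : List B'}
    (h : Accepts Tr' fin' c r u v o) {q : Q} (hq : f q = r) :
    ∃ u' v', u'.map e = u ∧ v'.map e' = v ∧ Accepts Tr fin c q u' v' o := by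
  induction h generalizing q with
  | nil h =>
    obtain ⟨q₁, h₁, h₂⟩ := hfin _ h
    obtain rfl := hf (hq.trans h₂.symm)
    exact ⟨[], [], rfl, rfl, .nil h₁⟩
  | read h _ ih =>
    obtain ⟨q₁, y, p', q', h₁, h₂, h₃, rfl, h₄⟩ := hTr _ _ _ _ h
    obtain rfl := hf (hq.trans h₂.symm)
    obtain ⟨u', v', rfl, rfl, h₅⟩ := ih h₄
    obtain ⟨a, rfl, rfl⟩ := Option.map_eq_some_iff.1 h₃
    exact ⟨a :: u', p' ++ v', by simp, by simp,
      by simpa [Function.comp_def] using Accepts.read h₁ h₅⟩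
  | eps h _ ih =>
    obtain ⟨q₁, y, p', q', h₁, h₂, h₃, rfl, h₄⟩ := hTr _ _ _ _ h
    obtain rfl := hf (hq.trans h₂.symm)
    obtain ⟨u', v', rfl, rfl, h₅⟩ := ih h₄
    obtain rfl := Option.map_eq_none_iff.1 h₃
    exact ⟨u', p' ++ v', by simp, by simp,
      by simpa [Function.comp_def] using Accepts.eps h₁ h₅⟩

end Basic

theorem of_runData_cons {L : List NTrans} {fin : ℕ → Prop} {c q : ℕ} {x : Option ℕ} {p : List ℕ}
    {q' : ℕ} {ts : List NTrans} (h : (q, x, p, q') ∈ L)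
    (hts : ∀ c, Accepts (fun q x p q' => (q, x, p, q') ∈ L) fin c q'
      (runData c ts).1 (runData c ts).2.1 (runData c ts).2.2) :
    Accepts (fun q x p q' => (q, x, p, q') ∈ L) fin c q
      (runData c ((q, x, p, q') :: ts)).1 (runData c ((q, x, p, q') :: ts)).2.1
      (runData c ((q, x, p, q') :: ts)).2.2 := by
  cases x with
  | none => exact .eps h (hts c)
  | some a => exact .read h (hts (c + 1))

theorem of_run {L : List NTrans} {fin : List ℕ} (ts : List NTrans) (t : NTrans)
    (hL : ∀ t' ∈ t :: ts, t' ∈ L)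
    (hfin : (t :: ts).getLast?.elim False fun t' => t'.2.2.2 ∈ fin)
    (hts : (t :: ts).IsChain fun s t => s.2.2.2 = t.1) (c : ℕ) :
    Accepts (fun q x p q' => (q, x, p, q') ∈ L) (· ∈ fin) c t.1
      (runData c (t :: ts)).1 (runData c (t :: ts)).2.1 (runData c (t :: ts)).2.2 := by
  induction ts generalizing c t with
  | nil =>
    exact of_runData_cons (hL t (by simp)) fun c => .nil (by simpa using hfin)
  | cons t' ts ih =>
    refine of_runData_cons (hL t (by simp)) fun c => ?_
    rw [List.isChain_cons_cons] at hts
    rw [hts.1]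
    exact ih t' (fun t'' h => hL t'' (by simp [h])) (by simpa using hfin) hts.2 c

theorem exists_run {L : List NTrans} {fin : List ℕ} {c q : ℕ} {u v o : List ℕ}
    (h : Accepts (fun q x p q' => (q, x, p, q') ∈ L) (· ∈ fin) c q u v o) :
    ∃ ts : List NTrans, runData c ts = (u, v, o) ∧ (∀ t ∈ ts, t ∈ L) ∧
      (ts.head?.elim True fun t => t.1 = q) ∧
      (ts.getLast?.elim (q ∈ fin) fun t => t.2.2.2 ∈ fin) ∧
      ts.IsChain fun s t => s.2.2.2 = t.1 := by
  have key : ∀ (t : NTrans) (ts : List NTrans), t ∈ L → (∀ t ∈ ts, t ∈ L) →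
      (ts.head?.elim True fun t' => t'.1 = t.2.2.2) →
      (ts.getLast?.elim (t.2.2.2 ∈ fin) fun t => t.2.2.2 ∈ fin) →
      (ts.IsChain fun s t => s.2.2.2 = t.1) →
      (∀ t' ∈ t :: ts, t' ∈ L) ∧ ((t :: ts).head?.elim True fun t' => t'.1 = t.1) ∧
      ((t :: ts).getLast?.elim (t.1 ∈ fin) fun t => t.2.2.2 ∈ fin) ∧
      (t :: ts).IsChain fun s t => s.2.2.2 = t.1 := by
    intro t ts h₁ h₂ h₃ h₄ h₅
    refine ⟨List.forall_mem_cons.2 ⟨h₁, h₂⟩, by simp, ?_, ?_⟩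
    · cases ts with
      | nil => simpa using h₄
      | cons t' ts => simpa [List.getLast?_cons_cons, List.getLast?_eq_some_getLast] using h₄
    · cases ts with
      | nil => simp
      | cons t' ts => exact List.isChain_cons_cons.2 ⟨by simpa using h₃.symm, h₅⟩
  induction h with
  | nil h => exact ⟨[], rfl, by simp, trivial, h, by simp⟩
  | @read c q a p q' u v o h _ ih =>
    obtain ⟨ts, h₁, h₂, h₃, h₄, h₅⟩ := ih
    exact ⟨(q, some a, p, q') :: ts, by simp [runData, h₁], key _ ts h h₂ h₃ h₄ h₅⟩
  | @eps c q p q' u v o h _ ih =>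
    obtain ⟨ts, h₁, h₂, h₃, h₄, h₅⟩ := ih
    exact ⟨(q, none, p, q') :: ts, by simp [runData, h₁], key _ ts h h₂ h₃ h₄ h₅⟩

end Accepts

theorem mem_OSem_iff_acc {T : NT1} {g : OriginGraph ℕ ℕ} :
    g ∈ OSem T ↔ ∃ q ∈ T.2.1, ∃ o,
      Accepts (fun q x p q' => (q, x, p, q') ∈ T.1) (· ∈ T.2.2) 0 q g.inp g.out o ∧
      ∀ z, 1 ≤ z → z ≤ g.out.length → g.orig z = o.getD (z - 1) 1 := by
  constructor
  · rintro ⟨ts, ⟨hne, hL, hI, hF, hC⟩, hu, hv, ho⟩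
    obtain ⟨t, ts, rfl⟩ := List.exists_cons_of_ne_nil hne
    refine ⟨t.1, by simpa using hI, _, ?_, ho⟩
    rw [hu, hv]
    exact Accepts.of_run ts t hL hF hC 0
  · rintro ⟨q, hq, o, h, ho⟩
    obtain ⟨ts, h₁, h₂, h₃, h₄, h₅⟩ := h.exists_run
    cases ts with
    | nil => exact absurd (congrArg Prod.fst h₁).symm g.inp_ne
    | cons t ts =>
      refine ⟨t :: ts, ⟨by simp, h₂, ?_, ?_, h₅⟩, by rw [h₁], by rw [h₁], by rwa [h₁]⟩
      · simp only [List.head?_cons, Option.elim_some] at h₃ ⊢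
        rwa [h₃]
      · simpa [List.getLast?_eq_some_getLast] using h₄

theorem mem_OSem_iff {Q A : Type} {Tr : Q → Option A → List A → Q → Prop} {init fin : Q → Prop}
    {f : Q → ℕ} {e : A → ℕ} (hf : f.Injective) {T : NT1}
    (hTr : ∀ t, t ∈ T.1 ↔ ∃ q x p q', Tr q x p q' ∧ (f q, x.map e, p.map e, f q') = t)
    (hI : ∀ r, r ∈ T.2.1 ↔ ∃ q, init q ∧ f q = r) (hF : ∀ r, r ∈ T.2.2 ↔ ∃ q, fin q ∧ f q = r)
    {g : OriginGraph ℕ ℕ} :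
    g ∈ OSem T ↔ ∃ q u v o, init q ∧ u.map e = g.inp ∧ v.map e = g.out ∧ Accepts Tr fin 0 q u v o ∧
      ∀ z, 1 ≤ z → z ≤ v.length → g.orig z = o.getD (z - 1) 1 := by
  rw [mem_OSem_iff_acc]
  constructor
  · rintro ⟨r, hr, o, h, ho⟩
    obtain ⟨q, hq, rfl⟩ := (hI r).1 hr
    obtain ⟨u, v, hu, hv, h⟩ := h.of_map (Tr := Tr) (fin := fin) e e hf (fun r x p r' h => by
      obtain ⟨q, y, p', q', h₁, h₂⟩ := (hTr _).1 h
      simp only [Prod.mk.injEq] at h₂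
      exact ⟨q, y, p', q', h₁, h₂⟩) (fun r h => (hF r).1 h) rfl
    refine ⟨q, u, v, o, hq, hu, hv, h, fun z h₁ h₂ => ho z h₁ ?_⟩
    rwa [← hv, List.length_map]
  · rintro ⟨q, u, v, o, hq, hu, hv, h, ho⟩
    refine ⟨f q, (hI _).2 ⟨q, hq, rfl⟩, o, ?_, fun z h₁ h₂ => ho z h₁ ?_⟩
    · rw [← hu, ← hv]
      exact h.map f e e (fun q x p q' h => (hTr _).2 ⟨q, x, p, q', h, rfl⟩)
        fun q h => (hF _).2 ⟨q, h, rfl⟩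
    · rwa [← hv, List.length_map] at h₂

/-- The automaton checking that the position marked as source is among the first `K` positions or
is the position marked as target. -/
def nearDFA (Sig : Type) (K : ℕ) : DFA (RLetter Sig 0) (Fin (K + 1) × Bool) where
  step s l := (⟨min (s.1 + 1) K, by omega⟩, s.2 || (l.2.2.1 && (decide (s.1.1 < K) || l.2.2.2)))
  start := (0, false)
  accept := {s | s.2 = true}

theorem nearDFA_evalFrom {Sig : Type} {K : ℕ} (w : List (RLetter Sig 0)) (s : Fin (K + 1) × Bool) :
    (nearDFA Sig K).evalFrom s w ∈ (nearDFA Sig K).accept ↔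
      s.2 = true ∨ ∃ i l, w[i]? = some l ∧ l.2.2.1 = true ∧ (s.1 + i < K ∨ l.2.2.2 = true) := by
  induction w generalizing s with
  | nil => simp [nearDFA]
  | cons l w ih =>
    rw [DFA.evalFrom_cons, ih]
    simp only [nearDFA, Bool.or_eq_true, Bool.and_eq_true, decide_eq_true_eq]
    constructor
    · rintro ((h | h) | ⟨i, l', h₁, h₂, h₃⟩)
      · exact .inl h
      · exact .inr ⟨0, l, rfl, h.1, by simpa using h.2⟩
      · exact .inr ⟨i + 1, l', by simpa using h₁, h₂, h₃.imp_left (by omega)⟩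
    · rintro (h | ⟨_ | i, l', h₁, h₂, h₃⟩)
      · exact .inl (.inl h)
      · obtain rfl : l = l' := by simpa using h₁
        exact .inl (.inr ⟨h₂, by simpa using h₃⟩)
      · exact .inr ⟨i, l', by simpa using h₁, h₂, h₃.imp_left (by omega)⟩

theorem rSat_nearDFA {Sig : Type} {K : ℕ} (u : List Sig) (I : Fin 0 → ℕ → Bool) {x y : ℕ}
    (hx : 1 ≤ x) (hxu : x ≤ u.length) :
    RSat ((nearDFA Sig K).accepts : Set _) u I x y ↔ x ≤ K ∨ x = y := by
  have h : RSat ((nearDFA Sig K).accepts : Set _) u I x y ↔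
      (nearDFA Sig K).evalFrom (nearDFA Sig K).start (annot u I x y) ∈ (nearDFA Sig K).accept :=
    Iff.rfl
  rw [h, nearDFA_evalFrom]
  simp only [nearDFA, annot, List.getElem?_mapIdx, Option.map_eq_some_iff]
  constructor
  · rintro (h | ⟨i, l, ⟨a, h, rfl⟩, h₁, h₂⟩)
    · simp at h
    · simp only [decide_eq_true_eq, Fin.val_zero] at h₁ h₂
      omega
  · intro h
    refine .inr ⟨x - 1, _, ⟨u[x - 1], List.getElem?_eq_getElem (by omega), rfl⟩, ?_, ?_⟩
    · simp only [decide_eq_true_eq]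
      omega
    · simp only [decide_eq_true_eq, Fin.val_zero]
      omega

theorem resyncLE_of_origin_le {Sig Gam : Type} {S₁ S₂ : Set (OriginGraph Sig Gam)} (K : ℕ)
    (h : ∀ g₁ ∈ S₁, ∃ g₂ ∈ S₂, g₂.inp = g₁.inp ∧ g₂.out = g₁.out ∧
      ∀ z, 1 ≤ z → z ≤ g₁.out.length → g₂.orig z ≤ K ∨ g₂.orig z = g₁.orig z) :
    ResyncLE S₁ S₂ := by
  refine ⟨0, ((nearDFA Sig K).accepts : Set _), ⟨_, inferInstance, _, rfl⟩, ⟨K + 1, ?_⟩, ?_⟩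
  · intro u I y _ _
    refine (Set.ncard_le_ncard (t := ((insert y (Finset.Icc 1 K) : Finset ℕ) : Set ℕ)) ?_
      (Finset.finite_toSet _)).trans ?_
    · rintro x ⟨h₁, h₂, h₃⟩
      rw [rSat_nearDFA u I h₁ h₂] at h₃
      simp only [Finset.coe_insert, Finset.coe_Icc, Set.mem_insert_iff, Set.mem_Icc]
      omega
    · rw [Set.ncard_coe_finset]
      exact (Finset.card_insert_le _ _).trans (by simp)
  · intro g₁ hg₁
    obtain ⟨g₂, hg₂, hi, ho, hz⟩ := h g₁ hg₁
    refine ⟨g₂, hg₂, hi, ho, fun i => i.elim0, fun z h₁ h₂ => ?_⟩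
    have := g₂.orig_mem z h₁ (by rwa [ho])
    exact (rSat_nearDFA _ _ this.1 this.2).2 (hz z h₁ h₂)

/-- States of the transducers reduced to from the halting problem of a queue automaton with states
`S`. -/
inductive CheckState (S : Type)
  | scan
  | dump
  | copy
  | skip
  | free
  | init
  | sim (s : S)

/-- Transitions not depending on the initial queue. A run from `copy` copies the input until the
end or until the output differs from the input. A run in `sim s` reads a history of the queue of
the automaton with control `δ` and outputs the letters pushed, until halting or until an error
occurs in the output. -/
inductive CheckTrans {S A : Type} (δ : S → A → Option (S × List A)) :
    CheckState S → Option A → List A → CheckState S → Prop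
  | scan a : CheckTrans δ .scan (some a) [] .scan
  | dump a : CheckTrans δ .dump none [a] .dump
  | copy a : CheckTrans δ .copy (some a) [a] .copy
  | copyEnd : CheckTrans δ .copy none [] .dump
  | differ {a b} : a ≠ b → CheckTrans δ .copy (some a) [b] .free
  | quit : CheckTrans δ .copy none [] .skip
  | skip a : CheckTrans δ .skip (some a) [] .skip
  | write a : CheckTrans δ .free none [a] .free
  | read a : CheckTrans δ .free (some a) [] .free
  | sim {s a s' p} : δ s a = some (s', p) → CheckTrans δ (.sim s) (some a) p (.sim s')
  | error {s a s' p₁ b p₂ b'} : δ s a = some (s', p₁ ++ b :: p₂) → b ≠ b' →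
      CheckTrans δ (.sim s) (some a) (p₁ ++ [b']) .free
  | halt {s a} : δ s a = none → CheckTrans δ (.sim s) (some a) [] .free

/-- All transitions, for the initial state `s₀` and the initial queue `w` of the automaton. -/
inductive CheckTransFrom {S A : Type} (δ : S → A → Option (S × List A)) (s₀ : S) (w : List A) :
    CheckState S → Option A → List A → CheckState S → Prop
  | of {q x p q'} : CheckTrans δ q x p q' → CheckTransFrom δ s₀ w q x p q'
  | emit : CheckTransFrom δ s₀ w .scan none w .dump
  | start : CheckTransFrom δ s₀ w .init none w (.sim s₀)

/-- Final states. -/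
inductive CheckFinal {S : Type} : CheckState S → Prop
  | dump : CheckFinal .dump
  | skip : CheckFinal .skip
  | free : CheckFinal .free

namespace CheckTransFrom

section Runs

variable {S A : Type} {δ : S → A → Option (S × List A)} {s₀ : S} {w : List A}

theorem accepts_dump (c : ℕ) (v : List A) :
    Accepts (CheckTransFrom δ s₀ w) CheckFinal c .dump [] v (v.map fun _ => max c 1) := by
  induction v with
  | nil => exact .nil .dump
  | cons a v ih => exact .eps (.of (.dump a)) ih

theorem accepts_skip (c : ℕ) (u : List A) :
    Accepts (CheckTransFrom δ s₀ w) CheckFinal c .skip u [] [] := by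
  induction u generalizing c with
  | nil => exact .nil .skip
  | cons a u ih => exact .read (.of (.skip a)) (ih _)

theorem accepts_free (c : ℕ) (u v : List A) :
    Accepts (CheckTransFrom δ s₀ w) CheckFinal c .free u v (v.map fun _ => max c 1) := by
  induction v with
  | nil =>
    induction u generalizing c with
    | nil => exact .nil .free
    | cons a u ih => exact .read (.of (.read a)) (ih _)
  | cons a v ih => exact .eps (.of (.write a)) ih

theorem accepts_scan (c : ℕ) (u v : List A) :
    Accepts (CheckTransFrom δ s₀ w) CheckFinal c .scan u (w ++ v)
      ((w ++ v).map fun _ => max (c + u.length) 1) := by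
  induction u generalizing c with
  | nil =>
    rw [List.map_append]
    exact .eps .emit (accepts_dump c v)
  | cons a u ih =>
    have h : c + (a :: u).length = c + 1 + u.length := by rw [List.length_cons]; omega
    rw [h]
    exact .read (.of (.scan a)) (ih _)

theorem output_of_accepts_scan {c : ℕ} {q : CheckState S} {u v : List A} {o : List ℕ}
    (h : Accepts (CheckTransFrom δ s₀ w) CheckFinal c q u v o) (hq : q = .scan) : w <+: v := by
  induction h with
  | nil h => subst hq; cases h
  | read h _ ih =>
    subst hq
    obtain ⟨⟨⟩⟩ := h
    exact ih rfl
  | eps h _ _ =>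
    subst hq
    rcases h with ⟨⟨⟩⟩ | _
    exact List.prefix_append _ _

theorem input_of_accepts_dump {c : ℕ} {q : CheckState S} {u v : List A} {o : List ℕ}
    (h : Accepts (CheckTransFrom δ s₀ w) CheckFinal c q u v o) (hq : q = .dump) : u = [] := by
  induction h with
  | nil => rfl
  | read h _ _ =>
    subst hq
    obtain ⟨⟨⟩⟩ := h
  | eps h _ ih =>
    subst hq
    obtain ⟨⟨⟩⟩ := h
    exact ih rfl

theorem output_of_accepts_skip {c : ℕ} {q : CheckState S} {u v : List A} {o : List ℕ}
    (h : Accepts (CheckTransFrom δ s₀ w) CheckFinal c q u v o) (hq : q = .skip) : v = [] := by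
  induction h with
  | nil => rfl
  | read h _ ih =>
    subst hq
    obtain ⟨⟨⟩⟩ := h
    exact ih rfl
  | eps h _ _ =>
    subst hq
    obtain ⟨⟨⟩⟩ := h

/-- If the input is a prefix of the output then it has to be copied. -/
theorem mem_of_accepts_copy {c : ℕ} {q : CheckState S} {u v : List A} {o : List ℕ}
    (h : Accepts (CheckTransFrom δ s₀ w) CheckFinal c q u v o) (hq : q = .copy) (huv : u <+: v)
    {j : ℕ} (hj : c < j) (hju : j ≤ c + u.length) : j ∈ o := by
  induction h with
  | nil => simp only [List.length_nil] at hju; omega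
  | read h _ ih =>
    subst hq
    simp only [List.length_cons] at hju
    rcases h with ⟨_ | _ | _⟩
    · rw [List.singleton_append, List.cons_prefix_cons] at huv
      rcases Nat.lt_or_ge (_ + 1) j with h | h
      · exact List.mem_append_right _ (ih rfl huv.2 h (by omega))
      · simp only [List.map_cons, List.map_nil, List.singleton_append, List.mem_cons]
        left
        omega
    · rename_i hne _
      rw [List.singleton_append, List.cons_prefix_cons] at huv
      exact absurd huv.1 hne
  | eps h h' _ =>
    subst hq
    rcases h with ⟨_ | _ | _⟩
    · obtain rfl := input_of_accepts_dump h' rfl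
      simp only [List.length_nil] at hju
      omega
    · obtain rfl := output_of_accepts_skip h' rfl
      obtain rfl := List.prefix_nil.1 huv
      simp only [List.length_nil] at hju
      omega

/-- If input and output have no long common prefix then this is checked by copying. -/
theorem exists_accepts_copy (K c : ℕ) (u v : List A)
    (h : ¬ ∃ z : List A, K ≤ z.length ∧ z <+: u ∧ z <+: v) :
    ∃ o, Accepts (CheckTransFrom δ s₀ w) CheckFinal c .copy u v o ∧
      ∀ x ∈ o, x ≤ max c 1 + K := by
  induction K generalizing c u v with
  | zero => exact absurd ⟨[], Nat.zero_le _, List.nil_prefix, List.nil_prefix⟩ h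
  | succ K ih =>
    rcases u with _ | ⟨a, u⟩
    · refine ⟨_, .eps (.of .copyEnd) (accepts_dump c v), ?_⟩
      simp only [List.map_nil, List.nil_append, List.mem_map]
      rintro x ⟨_, -, rfl⟩
      omega
    rcases v with _ | ⟨b, v⟩
    · exact ⟨_, .eps (.of .quit) (accepts_skip c _), by simp⟩
    by_cases hab : a = b
    · subst hab
      obtain ⟨o, ho, hx⟩ := ih (c + 1) u v fun ⟨z, h₁, h₂, h₃⟩ => h ⟨a :: z, by simpa using h₁,
        List.cons_prefix_cons.2 ⟨rfl, h₂⟩, List.cons_prefix_cons.2 ⟨rfl, h₃⟩⟩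
      refine ⟨_, .read (.of (.copy a)) ho, ?_⟩
      simp only [List.map_cons, List.map_nil, List.singleton_append, List.mem_cons]
      rintro x (rfl | h)
      · omega
      · have := hx x h
        omega
    · refine ⟨_, .read (.of (.differ hab)) (accepts_free (c + 1) u v), ?_⟩
      simp only [List.map_cons, List.map_nil, List.singleton_append, List.mem_cons, List.mem_map]
      rintro x (rfl | ⟨_, -, rfl⟩) <;> omega

theorem prefix_or_exists_ne (p v : List A) (h : p.length ≤ v.length) :
    p <+: v ∨ ∃ p₁ b p₂ b' v', b ≠ b' ∧ p = p₁ ++ b :: p₂ ∧ v = p₁ ++ b' :: v' := by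
  induction p generalizing v with
  | nil => exact .inl List.nil_prefix
  | cons a p ih =>
    rcases v with _ | ⟨b, v⟩
    · simp at h
    by_cases hab : a = b
    · subst hab
      rcases ih v (by simpa using h) with h | ⟨p₁, b, p₂, b', v', hb, rfl, rfl⟩
      · exact .inl (List.cons_prefix_cons.2 ⟨rfl, h⟩)
      · exact .inr ⟨a :: p₁, b, p₂, b', v', hb, rfl, rfl⟩
    · exact .inr ⟨[], a, p, b, v, hab, rfl, rfl⟩

open StateTransition in
/-- If the queue automaton halts then the histories of the queue which are long enough are
accepted. -/
theorem exists_accepts_sim {s : S} {q : List A} {t : S × List A} {a : A} {q' : List A}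
    (h : Reaches (queueStep δ) (s, q) t) (ht : t.2 = a :: q') (ha : δ t.1 a = none) :
    ∃ K, ∀ (c : ℕ) (z u v : List A), K ≤ z.length → z <+: u → z <+: q ++ v →
      ∃ o, Accepts (CheckTransFrom δ s₀ w) CheckFinal c (.sim s) u v o ∧
        ∀ x ∈ o, x ≤ max c 1 + K := by
  generalize hd : (s, q) = d at h
  induction h using Relation.ReflTransGen.head_induction_on generalizing s q with
  | refl =>
    subst hd
    obtain rfl : q = a :: q' := ht
    refine ⟨1, fun c z u v hz hu hv => ?_⟩
    obtain ⟨b, z, rfl⟩ := List.exists_cons_of_length_pos hz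
    rw [List.cons_append, List.cons_prefix_cons] at hv
    obtain ⟨u, rfl⟩ := hu
    refine ⟨_, .read (.of (.halt (hv.1 ▸ ha))) (accepts_free (c + 1) _ v), ?_⟩
    simp only [List.map_nil, List.nil_append, List.mem_map]
    rintro x ⟨_, -, rfl⟩
    omega
  | head h _ ih =>
    subst hd
    rcases q with _ | ⟨b, q⟩
    · simp [queueStep] at h
    obtain ⟨⟨s', p⟩, hδ, rfl⟩ : ∃ r, δ s b = some r ∧ (r.1, q ++ r.2) = _ := by
      simpa [queueStep] using h
    obtain ⟨K, hK⟩ := ih rfl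
    refine ⟨K + q.length + p.length + 1, fun c z u v hz hu hv => ?_⟩
    have hlen := hv.length_le
    obtain ⟨b', z, rfl⟩ := List.exists_cons_of_length_pos (by omega : 0 < z.length)
    rw [List.cons_append, List.cons_prefix_cons] at hv
    obtain ⟨rfl, hv⟩ := hv
    obtain ⟨u', rfl⟩ := hu
    simp only [List.length_cons, List.length_append] at hz hlen
    rcases prefix_or_exists_ne p v (by omega) with ⟨v, rfl⟩ | ⟨p₁, b, p₂, b', v, hb, rfl, rfl⟩
    · obtain ⟨o, ho, hx⟩ := hK (c + 1) z (z ++ u') v (by omega) (List.prefix_append _ _)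
        (by simpa using hv)
      refine ⟨_, .read (.of (.sim hδ)) ho, ?_⟩
      intro x hx'
      rcases List.mem_append.1 hx' with h | h
      · obtain ⟨_, -, rfl⟩ := List.mem_map.1 h
        omega
      · have := hx x h
        omega
    · have h := Accepts.read (.of (.error hδ hb)) (accepts_free (s₀ := s₀) (w := w) (δ := δ)
        (c + 1) (z ++ u') v)
      rw [List.append_assoc, List.singleton_append] at h
      refine ⟨_, h, ?_⟩
      intro x hx'
      rcases List.mem_append.1 hx' with h | h <;>
      · obtain ⟨_, -, rfl⟩ := List.mem_map.1 h
        omega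

theorem input_ne_nil_of_accepts_sim {c : ℕ} {q : CheckState S} {s : S} {u v : List A} {o : List ℕ}
    (h : Accepts (CheckTransFrom δ s₀ w) CheckFinal c q u v o) (hq : q = .sim s) : u ≠ [] := by
  subst hq
  rcases h with ⟨⟨⟩⟩ | _ | ⟨⟨⟨⟩⟩⟩
  exact List.cons_ne_nil _ _

open StateTransition in
/-- If the queue automaton does not halt then some histories of the queue of any length are not
accepted. -/
theorem exists_not_accepts_sim (k : ℕ) {s : S} {q : List A}
    (h : ¬ (eval (queueStep δ) (s, q)).Dom) :
    ∃ u v : List A, u.length = k ∧ u <+: q ++ v ∧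
      ∀ c o, ¬ Accepts (CheckTransFrom δ s₀ w) CheckFinal c (.sim s) u v o := by
  induction k generalizing s q with
  | zero =>
    refine ⟨[], [], rfl, List.nil_prefix, fun c o ho => ?_⟩
    exact input_ne_nil_of_accepts_sim ho rfl rfl
  | succ k ih =>
    cases hs : queueStep δ (s, q) with
    | none => exact absurd (Part.dom_iff_mem.2 ⟨_, mem_eval.2 ⟨.refl, hs⟩⟩) h
    | some d =>
      rcases q with _ | ⟨a, q⟩
      · simp [queueStep] at hs
      obtain ⟨⟨s', p⟩, hδ, rfl⟩ : ∃ r, δ s a = some r ∧ (r.1, q ++ r.2) = d := by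
        simpa [queueStep] using hs
      have hd : ¬ (eval (queueStep δ) (s', q ++ p)).Dom := by
        rwa [reaches_eval (Relation.ReflTransGen.single hs)] at h
      obtain ⟨u, v, rfl, huv, hn⟩ := ih hd
      refine ⟨a :: u, p ++ v, rfl, ?_, fun c o ho => ?_⟩
      · rw [List.cons_append, List.cons_prefix_cons, ← List.append_assoc]
        exact ⟨rfl, huv⟩
      generalize hv : p ++ v = v' at ho
      generalize hu : a :: u = u' at ho
      rcases ho with _ | ⟨⟨h₁⟩, h₂⟩ | ⟨⟨⟨⟩⟩⟩
      · cases hu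
      · obtain ⟨rfl, rfl⟩ := List.cons.inj hu
        cases h₁ with
        | sim h =>
          rw [hδ] at h
          cases h
          rw [List.append_cancel_left hv] at hn
          exact hn _ _ h₂
        | error h hb =>
          rw [hδ] at h
          cases h
          simp only [List.append_assoc, List.cons_append, List.append_cancel_left_eq,
            List.cons.injEq] at hv
          exact hb hv.1
        | halt h =>
          rw [hδ] at h
          cases h

theorem not_accepts_init {u v : List A} {c : ℕ} {o : List ℕ}
    (h : ∀ c o, ¬ Accepts (CheckTransFrom δ s₀ w) CheckFinal c (.sim s₀) u v o) :
    ¬ Accepts (CheckTransFrom δ s₀ w) CheckFinal c .init u (w ++ v) o := by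
  intro ho
  generalize hv : w ++ v = v' at ho
  rcases ho with ⟨⟨⟩⟩ | ⟨⟨⟨⟩⟩⟩ | ⟨_ | _, h₂⟩
  · rename_i h
    cases h
  · rw [List.append_cancel_left hv] at h
    exact h _ _ h₂

end Runs

end CheckTransFrom

section CheckGraphs

variable {S A : Type} {δ : S → A → Option (S × List A)} {s₀ : S}

theorem finite_checkState [Finite S] : Finite (CheckState S) := by
  refine Finite.of_injective (β := Fin 6 ⊕ S) (fun q => match q with
    | .scan => .inl 0
    | .dump => .inl 1
    | .copy => .inl 2
    | .skip => .inl 3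
    | .free => .inl 4
    | .init => .inl 5
    | .sim s => .inr s) fun q q' h => ?_
  cases q <;> cases q' <;> simp_all

theorem finite_checkTrans [Finite S] [Finite A] (δ : S → A → Option (S × List A)) :
    {t : CheckState S × Option A × List A × CheckState S |
      CheckTrans δ t.1 t.2.1 t.2.2.1 t.2.2.2}.Finite := by
  obtain ⟨N, hN⟩ := (Set.finite_range fun x : S × A =>
    (δ x.1 x.2).elim 0 fun r => r.2.length).bddAbove
  have hN : ∀ s a s' p, δ s a = some (s', p) → p.length ≤ N := fun s a s' p h =>
    hN ⟨(s, a), by simp [h]⟩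
  have := finite_checkState (S := S)
  refine ((Set.finite_univ (α := CheckState S)).prod ((Set.finite_univ (α := Option A)).prod
    ((List.finite_length_le A (N + 1)).prod (Set.finite_univ (α := CheckState S))))).subset ?_
  rintro ⟨q, x, p, q'⟩ hx
  refine ⟨trivial, trivial, ?_, trivial⟩
  change CheckTrans δ q x p q' at hx
  change p.length ≤ N + 1
  cases hx with
  | sim h =>
    have := hN _ _ _ _ h
    omega
  | error h _ =>
    have := hN _ _ _ _ h
    simp only [List.length_append, List.length_cons, List.length_nil] at this ⊢
    omega
  | _ => simp

/-- The transducer over coded states and letters, for a coded initial queue `x`. -/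
def checkTransducer (s₀ : S) (f : CheckState S → ℕ) (L : List NTrans) (I : List (CheckState S))
    (x : List ℕ) : NT1 :=
  ((f .scan, none, x, f .dump) :: (f .init, none, x, f (.sim s₀)) :: L, I.map f,
    [f .dump, f .skip, f .free])

theorem primrec_checkTransducer (f : CheckState S → ℕ) (L : List NTrans)
    (I : List (CheckState S)) : Primrec (checkTransducer s₀ f L I) := by
  have h : ∀ m n : ℕ, Primrec fun x : List ℕ => ((m, none, x, n) : NTrans) := fun m n =>
    (Primrec.const m).pair ((Primrec.const none).pair (Primrec.id.pair (Primrec.const n)))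
  exact (Primrec.list_cons.comp (h _ _) (Primrec.list_cons.comp (h _ _) (Primrec.const L))).pair
    (Primrec.const _)

/-- Origin graphs of the runs starting from a state in `I`. -/
def checkGraphs (δ : S → A → Option (S × List A)) (s₀ : S) (w : List A) (e : A → ℕ)
    (I : List (CheckState S)) : Set (OriginGraph ℕ ℕ) :=
  {g | ∃ q u v o, q ∈ I ∧ u.map e = g.inp ∧ v.map e = g.out ∧
    Accepts (CheckTransFrom δ s₀ w) CheckFinal 0 q u v o ∧
    ∀ z, 1 ≤ z → z ≤ v.length → g.orig z = o.getD (z - 1) 1}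

theorem OSem_checkTransducer {f : CheckState S → ℕ} (hf : f.Injective) {e : A → ℕ}
    {L : List NTrans} (hL : ∀ t, t ∈ L ↔
      ∃ q x p q', CheckTrans δ q x p q' ∧ (f q, x.map e, p.map e, f q') = t)
    (I : List (CheckState S)) (w : List A) :
    OSem (checkTransducer s₀ f L I (w.map e)) = checkGraphs δ s₀ w e I := by
  ext g
  refine mem_OSem_iff hf (fun t => ?_) (fun r => by simp [checkTransducer]) fun r => ?_
  · simp only [checkTransducer, List.mem_cons, hL]
    constructor
    · rintro (rfl | rfl | ⟨q, x, p, q', h, rfl⟩)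
      · exact ⟨_, _, _, _, .emit, rfl⟩
      · exact ⟨_, _, _, _, .start, rfl⟩
      · exact ⟨_, _, _, _, .of h, rfl⟩
    · rintro ⟨q, x, p, q', h, rfl⟩
      cases h with
      | of h => exact .inr (.inr ⟨_, _, _, _, h, rfl⟩)
      | emit => exact .inl rfl
      | start => exact .inr (.inl rfl)
  · simp only [checkTransducer, List.mem_cons, List.not_mem_nil, or_false]
    constructor
    · rintro (rfl | rfl | rfl)
      · exact ⟨_, .dump, rfl⟩
      · exact ⟨_, .skip, rfl⟩
      · exact ⟨_, .free, rfl⟩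
    · rintro ⟨q, h, rfl⟩
      cases h <;> simp

theorem Accepts.exists_mem_checkGraphs {w : List A} (e : A → ℕ) {I : List (CheckState S)}
    {q : CheckState S} {u v : List A} {o : List ℕ}
    (h : Accepts (CheckTransFrom δ s₀ w) CheckFinal 0 q u v o) (hq : q ∈ I) (hu : u ≠ []) :
    ∃ g ∈ checkGraphs δ s₀ w e I, g.inp = u.map e ∧ g.out = v.map e ∧
      ∀ z, 1 ≤ z → z ≤ v.length → g.orig z ∈ o := by
  have hmem : ∀ z, 1 ≤ z → z ≤ v.length → o.getD (z - 1) 1 ∈ o := fun z h₁ h₂ => by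
    rw [List.getD_eq_getElem _ _ (by rw [h.length_eq]; omega)]
    exact List.getElem_mem _
  refine ⟨⟨u.map e, v.map e, fun z => o.getD (z - 1) 1, by simpa using hu, fun z h₁ h₂ => ?_⟩,
    ⟨q, u, v, o, hq, rfl, rfl, h, fun _ _ _ => rfl⟩, rfl, rfl, hmem⟩
  have hx := h.origin_mem _ (hmem z h₁ (by simpa using h₂))
  have := List.length_pos_iff.2 hu
  rw [List.length_map]
  omega

theorem checkGraphs_mono {w : List A} {e : A → ℕ} {I I' : List (CheckState S)} (h : I ⊆ I') :
    checkGraphs δ s₀ w e I ⊆ checkGraphs δ s₀ w e I' :=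
  fun _ ⟨q, u, v, o, hq, hg⟩ => ⟨q, u, v, o, h hq, hg⟩

open StateTransition in
theorem resyncLE_checkGraphs_of_halt {w : List A} (e : A → ℕ) {s : S} {a : A} {w' : List A}
    (h : Reaches (queueStep δ) (s₀, w) (s, a :: w')) (ha : δ s a = none) :
    ResyncLE (checkGraphs δ s₀ w e [.scan, .copy, .init])
      (checkGraphs δ s₀ w e [.copy, .init]) := by
  obtain ⟨K, hK⟩ := CheckTransFrom.exists_accepts_sim (s₀ := s₀) (w := w) h rfl ha
  refine resyncLE_of_origin_le (1 + K) ?_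
  rintro g ⟨q, u, v, o, hq, hu, hv, hacc, ho⟩
  rw [List.mem_cons] at hq
  rcases hq with rfl | hq
  · obtain ⟨v, rfl⟩ := CheckTransFrom.output_of_accepts_scan hacc rfl
    obtain ⟨q, hq, o', h₁, h₂⟩ : ∃ q ∈ [CheckState.copy, .init], ∃ o',
        Accepts (CheckTransFrom δ s₀ w) CheckFinal 0 q u (w ++ v) o' ∧ ∀ x ∈ o', x ≤ 1 + K := by
      by_cases hz : ∃ z : List A, K ≤ z.length ∧ z <+: u ∧ z <+: w ++ v
      · obtain ⟨z, hz, hzu, hzv⟩ := hz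
        obtain ⟨o', h₁, h₂⟩ := hK 0 z u v hz hzu hzv
        refine ⟨.init, by simp, _, .eps .start h₁, fun x hx => ?_⟩
        rcases List.mem_append.1 hx with hx | hx
        · obtain ⟨_, -, rfl⟩ := List.mem_map.1 hx
          omega
        · simpa using h₂ x hx
      · obtain ⟨o', h₁, h₂⟩ := CheckTransFrom.exists_accepts_copy K 0 u _ hz
        exact ⟨.copy, by simp, o', h₁, by simpa using h₂⟩
    have hne : u ≠ [] := by
      rintro rfl
      exact g.inp_ne hu.symm
    obtain ⟨g', hg', hi, hout, horig⟩ := h₁.exists_mem_checkGraphs e hq hne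
    refine ⟨g', hg', hi.trans hu, hout.trans hv, fun z hz₁ hz₂ => .inl (h₂ _ (horig z hz₁ ?_))⟩
    rwa [← hv, List.length_map] at hz₂
  · exact ⟨g, ⟨q, u, v, o, hq, hu, hv, hacc, ho⟩, rfl, rfl, fun _ _ _ => .inr rfl⟩

open StateTransition in
theorem not_resyncLE_checkGraphs {w : List A} {e : A → ℕ} (he : e.Injective)
    (h : ¬ (eval (queueStep δ) (s₀, w)).Dom) :
    ¬ ResyncLE (checkGraphs δ s₀ w e [.scan, .copy, .init])
      (checkGraphs δ s₀ w e [.copy, .init]) := by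
  rintro ⟨m, γ, -, ⟨k, hk⟩, hγ⟩
  obtain ⟨u, v, hu, huv, hn⟩ := CheckTransFrom.exists_not_accepts_sim (s₀ := s₀) (w := w) (k + 1) h
  have hne : u ≠ [] := by
    rintro rfl
    simp at hu
  obtain ⟨g, hg, hi, ho, hg'⟩ := (CheckTransFrom.accepts_scan (δ := δ) (s₀ := s₀) (w := w) 0 u
    v).exists_mem_checkGraphs (I := [.scan, .copy, .init]) e (by simp) hne
  obtain ⟨g₂, ⟨q, u₂, v₂, o₂, hq, hu₂, hv₂, hacc, ho₂⟩, hi₂, hout₂, I, hI⟩ := hγ g hg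
  obtain rfl : u₂ = u := (List.map_injective_iff.2 he) (hu₂.trans (hi₂.trans hi))
  obtain rfl : v₂ = w ++ v := (List.map_injective_iff.2 he) (hv₂.trans (hout₂.trans ho))
  have hcopy : q = .copy := by
    simp only [List.mem_cons, List.not_mem_nil, or_false] at hq
    refine hq.resolve_right ?_
    rintro rfl
    exact CheckTransFrom.not_accepts_init hn hacc
  have hlen : g₂.inp.length = k + 1 := by rw [← hu₂, List.length_map, hu]
  have hb := hk g₂.inp I (k + 1) (by omega) hlen.ge
  have hsub : ((Finset.Icc 1 (k + 1) : Finset ℕ) : Set ℕ) ⊆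
      {x | 1 ≤ x ∧ x ≤ g₂.inp.length ∧ RSat γ g₂.inp I x (k + 1)} := by
    intro x hx
    rw [Finset.coe_Icc, Set.mem_Icc] at hx
    refine ⟨hx.1, by omega, ?_⟩
    obtain ⟨i, hi', rfl⟩ := List.mem_iff_getElem.1
      (CheckTransFrom.mem_of_accepts_copy hacc hcopy huv (j := x) (by omega) (by omega))
    rw [hacc.length_eq] at hi'
    have h₁ := hI (i + 1) (by omega) (by rw [ho, List.length_map]; omega)
    rw [ho₂ (i + 1) (by omega) (by omega), Nat.add_sub_cancel,
      List.getD_eq_getElem _ _ (by rwa [hacc.length_eq])] at h₁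
    obtain ⟨_, -, h₂⟩ := List.mem_map.1 (hg' (i + 1) (by omega) (by omega))
    rw [← h₂, Nat.zero_add, hu, max_eq_left (by omega)] at h₁
    exact h₁
  have hfin : {x | 1 ≤ x ∧ x ≤ g₂.inp.length ∧ RSat γ g₂.inp I x (k + 1)}.Finite :=
    (Set.finite_Icc 1 g₂.inp.length).subset fun x hx => ⟨hx.1, hx.2.1⟩
  have := (Set.ncard_le_ncard hsub hfin).trans hb
  rw [Set.ncard_coe_finset, Nat.card_Icc] at this
  omega

end CheckGraphs

theorem exists_list_checkTrans {S A : Type} [Finite S] [Finite A]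
    (δ : S → A → Option (S × List A)) (f : CheckState S → ℕ) (e : A → ℕ) :
    ∃ L : List NTrans, ∀ t, t ∈ L ↔
      ∃ q x p q', CheckTrans δ q x p q' ∧ (f q, x.map e, p.map e, f q') = t := by
  refine ⟨((finite_checkTrans δ).image fun t =>
    (f t.1, t.2.1.map e, t.2.2.1.map e, f t.2.2.2)).toFinset.toList, fun t => ?_⟩
  simp only [Finset.mem_toList, Set.Finite.mem_toFinset, Set.mem_image, Set.mem_ofPred_eq,
    Prod.exists]

/-- Equivalence up to an unknown bounded regular resynchronizer is undecidable for
one-way nondeterministic transducers: no algorithm decides, given two 1NTs `T₁, T₂`,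
whether `T₁ ∼ T₂`, i.e., whether both `T₁ ⪯ T₂` and `T₂ ⪯ T₁` hold. -/
theorem resyncEquiv_undecidable :
    ¬ ComputablePred fun p : NT1 × NT1 =>
        ResyncLE (OSem p.1) (OSem p.2) ∧ ResyncLE (OSem p.2) (OSem p.1) := by
  intro hdec
  obtain ⟨S, A, _, _, δ, s₀, w, e, he, hw, hc⟩ := exists_undecidable_queue
  have := finite_checkState (S := S)
  obtain ⟨f, hf⟩ := exists_injective_nat (CheckState S)
  obtain ⟨L, hL⟩ := exists_list_checkTrans δ f e
  have hsem := fun I n => OSem_checkTransducer (s₀ := s₀) hf hL I (w n)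
  have hcomp : ∀ I, Computable fun c : Nat.Partrec.Code =>
      checkTransducer s₀ f L I ((w (Encodable.encode c)).map e) := fun I =>
    (primrec_checkTransducer f L I).to_comp.comp (hw.comp Computable.encode)
  refine ComputablePred.halting_problem 0 (ComputablePred.computable_of_manyOneReducible
    ⟨_, (hcomp [.scan, .copy, .init]).pair (hcomp [.copy, .init]), fun c => ?_⟩ hdec)
  simp only [hsem]
  constructor
  · intro hd
    obtain ⟨s, a, w', h, ha⟩ := (hc c).1 hd
    exact ⟨resyncLE_checkGraphs_of_halt e h ha, resyncLE_of_origin_le 0 fun g hg =>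
      ⟨g, checkGraphs_mono (by simp) hg, rfl, rfl, fun _ _ _ => .inr rfl⟩⟩
  · rintro ⟨h, -⟩
    by_contra hd
    exact not_resyncLE_checkGraphs he ((hc c).2 hd) h
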